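/- arXiv:1505.06451 — 2 statements merged into one kernel-verified Lean document; each statement's English description precedes it below -/
import Mathlib

section
/- Let t₀ < 1 and let f : [t₀, 1) → ℝ be a C¹ function with f(t) ≤ −3 for all t ∈ [t₀, 1), and suppose f is unbounded from below, i.e. liminf_{t→1⁻} f(t) = −∞. Then ∫_{t₀}^{1} |f′(t)| / ((−f(t))·log(−f(t))) dt = +∞. -/
open Set Filter MeasureTheory

/-- A function whose lower limit along a filter is `-∞` is frequently below any real bound. -/
lemma frequently_lt_of_liminf_eq_bot {α : Type*} {l : Filter α} {f : α → ℝ}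
    (h : liminf (fun t => (f t : EReal)) l = ⊥) (c : ℝ) : ∃ᶠ t in l, f t < c := by
  have hlt : liminf (fun t => (f t : EReal)) l < (c : EReal) := by
    rw [h]
    exact EReal.bot_lt_coe c
  exact (frequently_lt_of_liminf_lt (h := hlt)).mono fun t ht => EReal.coe_lt_coe_iff.1 ht

/-- The increment of `log (log (-f))` bounds the integral of `|f'| / ((-f) log (-f))` from below. -/
lemma enorm_loglog_sub_le_lintegral {f : ℝ → ℝ} {a b : ℝ} (hab : a ≤ b)
    (hf : ContDiffOn ℝ 1 f (Icc a b)) (hlt : ∀ t ∈ Icc a b, f t < -1) :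
    ‖Real.log (Real.log (-f b)) - Real.log (Real.log (-f a))‖ₑ ≤
      ∫⁻ t in Icc a b, ENNReal.ofReal (|deriv f t| / ((-f t) * Real.log (-f t))) := by
  have hpos : ∀ t ∈ Icc a b, 0 < Real.log (-f t) := fun t ht =>
    Real.log_pos (by linarith [hlt t ht])
  have hg : ContDiffOn ℝ 1 (fun t => Real.log (Real.log (-f t))) (Icc a b) :=
    (hf.neg.log fun t ht => by linarith [hlt t ht]).log fun t ht => (hpos t ht).ne'
  refine (enorm_sub_le_lintegral_deriv_of_contDiffOn_Icc hg hab).trans_eq ?_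
  apply lintegral_congr_ae
  rw [← restrict_Ioo_eq_restrict_Icc]
  filter_upwards [self_mem_ae_restrict measurableSet_Ioo] with x hx
  have hx' := Ioo_subset_Icc_self hx
  have hfx : HasDerivAt f (deriv f x) x :=
    ((hf x hx').contDiffAt (Icc_mem_nhds hx.1 hx.2)).differentiableAt one_ne_zero |>.hasDerivAt
  have h1 := hlt x hx'
  have h2 := hpos x hx'
  have hd : HasDerivAt (fun t => Real.log (Real.log (-f t))) _ x :=
    (hfx.fun_neg.log (by linarith)).log h2.ne'
  rw [hd.deriv, Real.enorm_eq_ofReal_abs, abs_div, abs_div, abs_neg, abs_of_pos h2,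
    abs_of_pos (show 0 < -f x by linarith), div_div]

/-- Divergence estimate: if a `C¹` function `f ≤ −3` on `[t₀,1)` has
`liminf f = −∞` at `1⁻`, then `∫ |f′| / ((−f)·log(−f)) = +∞`. -/
theorem integral_inv_mul_log_of_liminf_bot (t₀ : ℝ) (ht₀ : t₀ < 1) (f : ℝ → ℝ)
    (hf : ContDiffOn ℝ 1 f (Set.Ico t₀ 1))
    (hle : ∀ t ∈ Set.Ico t₀ 1, f t ≤ -3)
    (hliminf : Filter.liminf (fun t => (f t : EReal)) (nhdsWithin 1 (Set.Iio 1)) = ⊥) :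
    ∫⁻ t in Set.Ico t₀ 1,
      ENNReal.ofReal (|derivWithin f (Set.Ico t₀ 1) t| / ((-f t) * Real.log (-f t))) = ⊤ := by
  refine ENNReal.eq_top_of_forall_nnreal_le fun r => ?_
  obtain ⟨b, hfb, hb⟩ := ((frequently_lt_of_liminf_eq_bot hliminf
    (-Real.exp (Real.exp (r + Real.log (Real.log (-f t₀)))))).and_eventually
      (Ico_mem_nhdsLT ht₀)).exists
  have hsub : Icc t₀ b ⊆ Ico t₀ 1 := Icc_subset_Ico_right hb.2
  have hlog : Real.exp (r + Real.log (Real.log (-f t₀))) < Real.log (-f b) :=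
    (Real.lt_log_iff_exp_lt (by linarith [hle b hb])).2 (by linarith)
  have hloglog : r + Real.log (Real.log (-f t₀)) < Real.log (Real.log (-f b)) :=
    (Real.lt_log_iff_exp_lt ((Real.exp_pos _).trans hlog)).2 hlog
  calc (r : ENNReal)
      ≤ ‖Real.log (Real.log (-f b)) - Real.log (Real.log (-f t₀))‖ₑ := by
        rw [Real.enorm_eq_ofReal_abs, ← ENNReal.ofReal_coe_nnreal]
        exact ENNReal.ofReal_le_ofReal (le_trans (by linarith) (le_abs_self _))
    _ ≤ ∫⁻ t in Icc t₀ b, ENNReal.ofReal (|deriv f t| / ((-f t) * Real.log (-f t))) :=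
        enorm_loglog_sub_le_lintegral hb.1 (hf.mono hsub) fun t ht => by
          linarith [hle t (hsub ht)]
    _ = ∫⁻ t in Icc t₀ b,
          ENNReal.ofReal (|derivWithin f (Ico t₀ 1) t| / ((-f t) * Real.log (-f t))) := by
        apply lintegral_congr_ae
        rw [← restrict_Ioo_eq_restrict_Icc]
        filter_upwards [self_mem_ae_restrict measurableSet_Ioo] with x hx
        rw [derivWithin_of_mem_nhds (Ico_mem_nhds hx.1 (hx.2.trans hb.2))]
    _ ≤ _ := lintegral_mono_set hsub
end

section
/- There exists a C^∞ function h : ℝ → ℝ such that h ≥ 0 on ℝ, h is monotone nondecreasing on ℝ, h is convex on ℝ, and h(t) = 1/log(−t) for all t ≤ −4. -/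
/-- A smooth function on `ℝ` has a smooth antiderivative with any prescribed value at a point. -/
theorem exists_contDiff_antiderivative {g : ℝ → ℝ} (hg : ContDiff ℝ (⊤ : ℕ∞) g) (c a : ℝ) :
    ∃ G : ℝ → ℝ, ContDiff ℝ (⊤ : ℕ∞) G ∧ G c = a ∧ ∀ t, HasDerivAt G (g t) t := by
  have hd : ∀ t, HasDerivAt (fun t => a + ∫ x in c..t, g x) (g t) t := fun t =>
    (hg.continuous.integral_hasStrictDerivAt c t).hasDerivAt.const_add a
  refine ⟨fun t => a + ∫ x in c..t, g x, ?_, by simp, hd⟩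
  rw [contDiff_infty_iff_deriv]
  refine ⟨fun t => (hd t).differentiableAt, ?_⟩
  rwa [funext fun t => (hd t).deriv]

/-- Two functions with the same derivative on `(-∞, c]` which agree at `c` agree on `(-∞, c]`. -/
theorem eq_of_hasDerivAt_eq_of_le {u v w : ℝ → ℝ} {c : ℝ}
    (hu : ∀ t ≤ c, HasDerivAt u (w t) t) (hv : ∀ t ≤ c, HasDerivAt v (w t) t)
    (hc : u c = v c) {t : ℝ} (ht : t ≤ c) : u t = v t := by
  have hd : ∀ x ≤ c, HasDerivAt (fun x => u x - v x) 0 x := fun x hx => by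
    simpa using (hu x hx).fun_sub (hv x hx)
  have := constant_of_has_deriv_right_zero (a := t) (b := c)
    (fun x hx => (hd x hx.2).continuousAt.continuousWithinAt)
    (fun x hx => (hd x hx.2.le).hasDerivWithinAt) c ⟨ht, le_rfl⟩
  linarith

theorem hasDerivAt_one_div_log_neg {t : ℝ} (ht : t < -1) :
    HasDerivAt (fun t : ℝ => 1 / Real.log (-t)) (1 / (-t * Real.log (-t) ^ 2)) t := by
  have hl : Real.log (-t) ≠ 0 := (Real.log_pos (by linarith)).ne'
  have h0 : t ≠ 0 := by linarith
  have h := ((hasDerivAt_id' t).fun_neg.log (neg_ne_zero.2 h0)).fun_inv hl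
  simp only [one_div]
  refine h.congr_deriv ?_
  field_simp

theorem hasDerivAt_deriv_one_div_log_neg {t : ℝ} (ht : t < -1) :
    HasDerivAt (fun t : ℝ => 1 / (-t * Real.log (-t) ^ 2))
      ((Real.log (-t) + 2) / (t ^ 2 * Real.log (-t) ^ 3)) t := by
  have hl : Real.log (-t) ≠ 0 := (Real.log_pos (by linarith)).ne'
  have h0 : t ≠ 0 := by linarith
  have hn := (hasDerivAt_id' t).fun_neg
  have h := (hn.fun_mul ((hn.log (neg_ne_zero.2 h0)).fun_pow 2)).fun_inv
    (mul_ne_zero (neg_ne_zero.2 h0) (pow_ne_zero 2 hl))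
  simp only [one_div]
  refine h.congr_deriv ?_
  field_simp
  ring

/-- There is a smooth nonnegative function on `ℝ` equal to the second derivative of
`1 / log (-t)` for `t ≤ -4`. -/
theorem exists_contDiff_nonneg_eq_deriv2_one_div_log_neg :
    ∃ g : ℝ → ℝ, ContDiff ℝ (⊤ : ℕ∞) g ∧ (∀ t, 0 ≤ g t) ∧
      ∀ t ≤ -4, g t = (Real.log (-t) + 2) / (t ^ 2 * Real.log (-t) ^ 3) := by
  refine ⟨fun t => Real.smoothTransition (-3 - t) *
    ((Real.log (-t) + 2) / (t ^ 2 * Real.log (-t) ^ 3)), ?_, fun t => ?_, fun t ht => ?_⟩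
  · rw [contDiff_iff_contDiffAt]
    intro t
    rcases lt_or_ge t (-2) with ht | ht
    · have hl : Real.log (-t) ≠ 0 := (Real.log_pos (by linarith)).ne'
      have h0 : t ≠ 0 := by linarith
      have hlog : ContDiffAt ℝ (⊤ : ℕ∞) (fun t : ℝ => Real.log (-t)) t :=
        contDiffAt_id.neg.log (neg_ne_zero.2 h0)
      have hs : ContDiffAt ℝ (⊤ : ℕ∞) (fun t : ℝ => Real.smoothTransition (-3 - t)) t :=
        (Real.smoothTransition.contDiff.comp (contDiff_const.sub contDiff_id)).contDiffAt
      exact hs.mul ((hlog.add contDiffAt_const).div ((contDiffAt_id.pow 2).mul (hlog.pow 3))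
        (mul_ne_zero (pow_ne_zero 2 h0) (pow_ne_zero 3 hl)))
    · refine (contDiffAt_const (c := (0 : ℝ))).congr_of_eventuallyEq ?_
      filter_upwards [lt_mem_nhds (show (-3 : ℝ) < t by linarith)] with x hx
      rw [Real.smoothTransition.zero_of_nonpos (by linarith), zero_mul]
  · rcases le_total t (-3) with ht | ht
    · have hl : 0 < Real.log (-t) := Real.log_pos (by linarith)
      exact mul_nonneg (Real.smoothTransition.nonneg _) (by positivity)
    · simp [Real.smoothTransition.zero_of_nonpos (show -3 - t ≤ 0 by linarith)]
  · simp [Real.smoothTransition.one_of_one_le (show 1 ≤ -3 - t by linarith)]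

/-- Existence of the auxiliary function `h` in the proof of Lemma 2.2: a smooth,
nonnegative, nondecreasing, convex function on `ℝ` equal to `1/log(−t)` for `t ≤ −4`. -/
theorem exists_smooth_convex_extension_of_one_div_log_neg :
    ∃ h : ℝ → ℝ, ContDiff ℝ (⊤ : ℕ∞) h ∧ (∀ t, 0 ≤ h t) ∧ Monotone h ∧
      ConvexOn ℝ Set.univ h ∧ ∀ t : ℝ, t ≤ -4 → h t = 1 / Real.log (-t) := by
  obtain ⟨g, hg, hg0, hgeq⟩ := exists_contDiff_nonneg_eq_deriv2_one_div_log_neg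
  obtain ⟨G, hG, hGc, hGd⟩ := exists_contDiff_antiderivative hg (-4)
    (1 / (-(-4) * Real.log (-(-4)) ^ 2))
  obtain ⟨h, hh, hhc, hhd⟩ := exists_contDiff_antiderivative hG (-4) (1 / Real.log (-(-4)))
  have hGeq : ∀ t ≤ -4, G t = 1 / (-t * Real.log (-t) ^ 2) := fun t ht =>
    eq_of_hasDerivAt_eq_of_le (w := g) (v := fun t => 1 / (-t * Real.log (-t) ^ 2))
      (fun x _ => hGd x)
      (fun x hx => hgeq x hx ▸ hasDerivAt_deriv_one_div_log_neg (by linarith)) hGc ht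
  have hheq : ∀ t ≤ -4, h t = 1 / Real.log (-t) := fun t ht =>
    eq_of_hasDerivAt_eq_of_le (w := G) (v := fun t => 1 / Real.log (-t))
      (fun x _ => hhd x)
      (fun x hx => hGeq x hx ▸ hasDerivAt_one_div_log_neg (by linarith)) hhc ht
  have hGmono : Monotone G := monotone_of_deriv_nonneg (fun t => (hGd t).differentiableAt)
    fun t => (hGd t).deriv ▸ hg0 t
  have hG0 : ∀ t, 0 ≤ G t := fun t => by
    refine le_trans ?_ (hGmono (min_le_left t (-4)))
    have hm : min t (-4) ≤ -4 := min_le_right _ _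
    rw [hGeq _ hm]
    exact one_div_nonneg.2 (mul_nonneg (by linarith) (sq_nonneg _))
  have hhmono : Monotone h := monotone_of_deriv_nonneg (fun t => (hhd t).differentiableAt)
    fun t => (hhd t).deriv ▸ hG0 t
  refine ⟨h, hh, fun t => ?_, hhmono, ?_, hheq⟩
  · refine le_trans ?_ (hhmono (min_le_left t (-4)))
    have hm : min t (-4) ≤ -4 := min_le_right _ _
    rw [hheq _ hm]
    exact one_div_nonneg.2 (Real.log_nonneg (by linarith))
  · refine Monotone.convexOn_univ_of_deriv (fun t => (hhd t).differentiableAt) ?_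
    rwa [funext fun t => (hhd t).deriv]
end
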